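/- Let D ⊆ ℂ be a domain and let W_n be random analytic functions on D such that for each x ∈ D there is an open subdomain D_x ∋ x and a random analytic function Z_x on D_x with W_n → Z_x in distribution in H(D_x) (the space of analytic functions with the topology of locally uniform convergence). Then there exists a random analytic function Z on D with W_n → Z in distribution in H(D) and Z restricted to D_x equal in distribution to Z_x for every x. -/

import Mathlib

open MeasureTheory Filter Topology

open scoped NNReal ENNReal BoundedContinuousFunction

/-- Ramp test function: `0` where `g ≤ M`, `1` where `g ≥ M + 1`. -/
noncomputable def rampFn {Y : Type*} [TopologicalSpace Y] (g : Y → ℝ) (hg : Continuous g)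
    (M : ℝ) : Y →ᵇ ℝ :=
  BoundedContinuousFunction.ofNormedAddCommGroup (fun y => max 0 (min 1 (g y - M)))
    (by fun_prop) 1 (by
      intro y
      rw [Real.norm_eq_abs, abs_of_nonneg (le_max_left _ _)]
      exact max_le zero_le_one (min_le_left _ _))

lemma rampFn_apply {Y : Type*} [TopologicalSpace Y] (g : Y → ℝ) (hg : Continuous g)
    (M : ℝ) (y : Y) : rampFn g hg M y = max 0 (min 1 (g y - M)) := rfl

lemma rampFn_small {Ω' : Type*} [MeasurableSpace Ω'] (P' : Measure Ω') [IsProbabilityMeasure P']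
    {Y : Type*} [TopologicalSpace Y] (g : Y → ℝ) (hg : Continuous g) (Z : Ω' → Y)
    (hZ : ∀ f : Y →ᵇ ℝ, AEStronglyMeasurable (fun ω => f (Z ω)) P') (δ : ℝ) (hδ : 0 < δ) :
    ∃ k : ℕ, ∫ ω, rampFn g hg k (Z ω) ∂P' < δ := by
  have h : Tendsto (fun k : ℕ => ∫ ω, rampFn g hg k (Z ω) ∂P') atTop (𝓝 (∫ _, (0 : ℝ) ∂P')) := by
    refine tendsto_integral_of_dominated_convergence (fun _ => 1) (fun k => hZ _)
      (integrable_const _) (fun k => Eventually.of_forall fun ω => ?_)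
      (Eventually.of_forall fun ω => ?_)
    · rw [rampFn_apply, Real.norm_eq_abs, abs_of_nonneg (le_max_left _ _)]
      exact max_le zero_le_one (min_le_left _ _)
    · refine tendsto_const_nhds.congr' ?_
      filter_upwards [eventually_ge_atTop ⌈g (Z ω)⌉₊] with k hk
      have : g (Z ω) ≤ k := (Nat.le_ceil _).trans (by exact_mod_cast hk)
      rw [rampFn_apply, max_eq_left]
      exact (min_le_right _ _).trans (by linarith)
  rw [integral_zero] at h
  exact (h.eventually (gt_mem_nhds hδ)).exists

lemma prob_le_of_ramp {Ω' : Type*} [MeasurableSpace Ω'] (P' : Measure Ω') [IsProbabilityMeasure P']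
    {Y : Type*} [TopologicalSpace Y] (g : Y → ℝ) (hg : Continuous g) (Z : Ω' → Y)
    (hZ : ∀ f : Y →ᵇ ℝ, AEStronglyMeasurable (fun ω => f (Z ω)) P') (δ : ℝ≥0) (M M' : ℝ)
    (h : ∫ ω, rampFn g hg M (Z ω) ∂P' < δ) (hM : M + 1 ≤ M') :
    P' {ω | M' < g (Z ω)} ≤ δ := by
  have h1 := mul_meas_ge_le_integral_of_nonneg (μ := P') (f := fun ω => rampFn g hg M (Z ω))
    (Eventually.of_forall fun ω => le_max_left _ _)
    (Integrable.of_bound (hZ _) ‖rampFn g hg M‖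
      (Eventually.of_forall fun ω => BoundedContinuousFunction.norm_coe_le_norm _ _)) 1
  have h2 : {ω | M' < g (Z ω)} ⊆ {ω | 1 ≤ rampFn g hg M (Z ω)} := by
    intro ω hω
    simp only [Set.mem_ofPred_eq, rampFn_apply] at hω ⊢
    exact le_max_of_le_right (le_min le_rfl (by linarith))
  refine (measure_mono h2).trans ?_
  rw [one_mul] at h1
  have h3 : P'.real {ω | 1 ≤ rampFn g hg M (Z ω)} ≤ δ := h1.trans h.le
  rw [← ENNReal.ofReal_coe_nnreal]
  exact (ENNReal.le_ofReal_iff_toReal_le (measure_ne_top _ _) δ.2).2 h3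

lemma limit_aesm {Ω Ω' : Type*} [MeasurableSpace Ω] [MeasurableSpace Ω']
    (P : Measure Ω) [IsProbabilityMeasure P] (P' : Measure Ω') [IsProbabilityMeasure P']
    {Y : Type*} [TopologicalSpace Y] (V : ℕ → Ω → Y) (Z : Ω' → Y)
    (hV : ∀ n, ∀ f : Y →ᵇ ℝ, AEStronglyMeasurable (fun ω => f (V n ω)) P)
    (h : ∀ f : Y →ᵇ ℝ, Tendsto (fun n => ∫ ω, f (V n ω) ∂P) atTop (𝓝 (∫ ω, f (Z ω) ∂P')))
    (f : Y →ᵇ ℝ) : AEStronglyMeasurable (fun ω => f (Z ω)) P' := by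
  by_contra hf
  have h0 : ∫ ω, f (Z ω) ∂P' = 0 := integral_non_aestronglyMeasurable hf
  have h1 : ∫ ω, (f + BoundedContinuousFunction.const Y (1 : ℝ)) (Z ω) ∂P' = 0 := by
    refine integral_non_aestronglyMeasurable fun hf' => hf ?_
    have := hf'.sub (aestronglyMeasurable_const (b := (1 : ℝ)))
    refine this.congr (Eventually.of_forall fun ω => ?_)
    simp
  have t0 := h f
  have t1 := h (f + BoundedContinuousFunction.const Y (1 : ℝ))
  rw [h0] at t0
  rw [h1] at t1
  have t2 := t0.add_const 1
  have : (fun n => ∫ ω, (f + BoundedContinuousFunction.const Y (1 : ℝ)) (V n ω) ∂P)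
      = fun n => ∫ ω, f (V n ω) ∂P + 1 := by
    funext n
    have hi : Integrable (fun ω => f (V n ω)) P :=
      Integrable.of_bound (hV n f) ‖f‖
        (Eventually.of_forall fun ω => BoundedContinuousFunction.norm_coe_le_norm _ _)
    simp [integral_add hi (integrable_const (1 : ℝ))]
  rw [this] at t1
  have := tendsto_nhds_unique t1 t2
  norm_num at this

lemma tight_norm {Ω Ω' : Type*} [MeasurableSpace Ω] [MeasurableSpace Ω']
    (P : Measure Ω) [IsProbabilityMeasure P] (P' : Measure Ω') [IsProbabilityMeasure P']
    {Y : Type*} [TopologicalSpace Y] (V : ℕ → Ω → Y) (Z : Ω' → Y)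
    (hV : ∀ n, ∀ f : Y →ᵇ ℝ, AEStronglyMeasurable (fun ω => f (V n ω)) P)
    (h : ∀ f : Y →ᵇ ℝ, Tendsto (fun n => ∫ ω, f (V n ω) ∂P) atTop (𝓝 (∫ ω, f (Z ω) ∂P')))
    (g : Y → ℝ) (hg : Continuous g) (δ : ℝ≥0) (hδ : 0 < δ) :
    ∃ M : ℝ, ∀ n, P {ω | M < g (V n ω)} ≤ δ := by
  have hδ' : (0 : ℝ) < δ := hδ
  obtain ⟨k, hk⟩ := rampFn_small P' g hg Z (limit_aesm P P' V Z hV h) δ hδ'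
  have hev := (h (rampFn g hg k)).eventually (gt_mem_nhds hk)
  obtain ⟨N, hN⟩ := eventually_atTop.1 hev
  choose m hm using fun n => rampFn_small P g hg (V n) (hV n) δ hδ'
  refine ⟨k + 1 + ∑ n ∈ Finset.range N, ((m n : ℝ) + 1), fun n => ?_⟩
  have hs : ∀ n, (0 : ℝ) ≤ m n + 1 := fun n => by positivity
  rcases le_or_gt N n with hn | hn
  · refine prob_le_of_ramp P g hg (V n) (hV n) δ k _ (hN n hn) ?_
    linarith [Finset.sum_nonneg fun i (_ : i ∈ Finset.range N) => hs i]
  · refine prob_le_of_ramp P g hg (V n) (hV n) δ (m n) _ (hm n) ?_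
    have := Finset.single_le_sum (fun i (_ : i ∈ Finset.range N) => hs i) (Finset.mem_range.2 hn)
    have hk0 : (0 : ℝ) ≤ k := Nat.cast_nonneg k
    linarith

/-- The set of analytic elements of `C(D, ℂ)`. -/
def holoSet (D : Set ℂ) : Set C(↥D, ℂ) :=
  {f | DifferentiableOn ℂ (Function.extend Subtype.val (⇑f) 0) D}

lemma ext_apply {D : Set ℂ} (f : C(↥D, ℂ)) (z : ↥D) :
    Function.extend Subtype.val (⇑f) 0 (z : ℂ) = f z :=
  Subtype.val_injective.extend_apply _ _ _

lemma isClosed_holoSet {D : Set ℂ} (hD : IsOpen D) : IsClosed (holoSet D) := by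
  have : LocallyCompactSpace ↥D := hD.locallyCompactSpace
  rw [isClosed_iff_ultrafilter]
  intro f u hu hmem
  have h1 : Tendsto (fun g : C(↥D, ℂ) => g) u (𝓝 f) := hu
  rw [ContinuousMap.tendsto_iff_tendstoLocallyUniformly] at h1
  have h2 : TendstoLocallyUniformlyOn
      (fun (g : C(↥D, ℂ)) => Function.extend Subtype.val (⇑g) 0)
      (Function.extend Subtype.val (⇑f) 0) (u : Filter C(↥D, ℂ)) D := by
    rw [tendstoLocallyUniformlyOn_iff_tendstoLocallyUniformly_comp_coe]
    have e : ∀ g : C(↥D, ℂ), Function.extend Subtype.val (⇑g) 0 ∘ (Subtype.val : ↥D → ℂ) = g :=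
      fun g => funext fun z => ext_apply g z
    rw [e]
    have e' : (fun (g : C(↥D, ℂ)) (x : ↥D) => Function.extend Subtype.val (⇑g) 0 (x : ℂ))
        = fun g x => g x := funext fun g => e g
    rw [e']
    exact h1
  exact h2.differentiableOn hmem hD

lemma compact_holo {D : Set ℂ} (hD : IsOpen D) {ι : Type*} (B : ι → Set ℂ) (M : ι → ℝ)
    (hB : ∀ x ∈ D, ∃ i, B i ∈ 𝓝 x) :
    IsCompact {f : C(↥D, ℂ) | f ∈ holoSet D ∧ ∀ i, ∀ z : ↥D, (z : ℂ) ∈ B i → ‖f z‖ ≤ M i} := by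
  set S := {f : C(↥D, ℂ) | f ∈ holoSet D ∧ ∀ i, ∀ z : ↥D, (z : ℂ) ∈ B i → ‖f z‖ ≤ M i} with hS
  have : LocallyCompactSpace ↥D := hD.locallyCompactSpace
  have hcl : IsClosed S := by
    refine (isClosed_holoSet hD).inter ?_
    change IsClosed {f : C(↥D, ℂ) | ∀ i, ∀ z : ↥D, (z : ℂ) ∈ B i → ‖f z‖ ≤ M i}
    simp only [Set.ofPred_forall]
    refine isClosed_iInter fun i => isClosed_iInter fun z => isClosed_iInter fun _ => ?_
    exact isClosed_le (continuous_eval_const z).norm continuous_const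
  rw [← hcl.closure_eq]
  refine ArzelaAscoli.isCompact_closure_of_isClosedEmbedding (ι := C(↥D, ℂ)) (X := ↥D)
    (F := fun f => (f : ↥D → ℂ)) (𝔖 := {K | IsCompact K}) (fun K hK => hK) ?_ ?_ ?_
  · refine ⟨ContinuousMap.isUniformEmbedding_toUniformOnFunIsCompact.isEmbedding, ?_⟩
    have : T2Space (UniformOnFun ↥D ℂ {K | IsCompact K}) :=
      UniformOnFun.t2Space_of_covering (Set.eq_univ_iff_forall.2 fun x =>
        Set.mem_sUnion_of_mem (Set.mem_singleton x) isCompact_singleton)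
    exact (ContinuousMap.isUniformEmbedding_toUniformOnFunIsCompact.isUniformInducing.isComplete_range).isClosed
  · intro K hK
    refine Equicontinuous.equicontinuousOn (fun c => ?_) K
    obtain ⟨i, hi⟩ := hB c c.2
    obtain ⟨ρ, hρ, hball⟩ := Metric.mem_nhds_iff.1 (Filter.inter_mem hi (hD.mem_nhds c.2))
    have hcB : (c : ℂ) ∈ B i := (hball (Metric.mem_ball_self hρ)).1
    refine Metric.equicontinuousAt_of_continuity_modulus
      (fun z : ↥D => (2 * M i) / ρ * dist (z : ℂ) c) ?_ _ ?_
    · have : Continuous (fun z : ↥D => (2 * M i) / ρ * dist (z : ℂ) c) := by fun_prop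
      simpa using this.tendsto c
    · have hn : ∀ᶠ z : ↥D in 𝓝 c, (z : ℂ) ∈ Metric.ball (c : ℂ) ρ :=
        continuous_subtype_val.continuousAt.eventually (Metric.ball_mem_nhds _ hρ)
      filter_upwards [hn] with z hz f
      have hd : DifferentiableOn ℂ (Function.extend Subtype.val (⇑f.1) 0)
          (Metric.ball (c : ℂ) ρ) := DifferentiableOn.mono f.2.1 (fun w hw => (hball hw).2)
      have := Complex.dist_le_div_mul_dist_of_mapsTo_ball (R₂ := 2 * M i) hd ?_ hz
      · rw [ext_apply, ext_apply] at this
        rw [dist_comm]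
        exact this
      · intro w hw
        have hwD := (hball hw).2
        have e : Function.extend Subtype.val (⇑f.1) 0 w = f.1 ⟨w, hwD⟩ := ext_apply f.1 ⟨w, hwD⟩
        rw [Metric.mem_closedBall, e, ext_apply, dist_eq_norm]
        have h1 := f.2.2 i ⟨w, hwD⟩ (hball hw).1
        have h2 := f.2.2 i c hcB
        exact (norm_sub_le _ _).trans (by linarith)
  · intro K hK x hx
    obtain ⟨i, hi⟩ := hB x x.2
    exact ⟨Metric.closedBall 0 (M i), isCompact_closedBall _ _, fun f hf => by
      rw [mem_closedBall_zero_iff]; exact hf.2 i x (mem_of_mem_nhds hi)⟩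

lemma polish_C {D : Set ℂ} (hD : IsOpen D) : PolishSpace C(↥D, ℂ) := by
  have : LocallyCompactSpace ↥D := hD.locallyCompactSpace
  have : TopologicalSpace.IsCompletelyMetrizableSpace C(↥D, ℂ) := inferInstance
  exact {}

/-- Restriction map. -/
noncomputable def restr {A D : Set ℂ} (h : A ⊆ D) (f : C(↥D, ℂ)) : C(↥A, ℂ) :=
  f.comp ⟨Set.inclusion h, continuous_inclusion h⟩

lemma continuous_restr {A D : Set ℂ} (h : A ⊆ D) : Continuous (restr h) :=
  ContinuousMap.continuous_precomp _

lemma restr_injOn {A D : Set ℂ} (h : A ⊆ D) (hD : IsOpen D) (hDc : IsConnected D)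
    (hA : IsOpen A) (hne : A.Nonempty) : Set.InjOn (restr h) (holoSet D) := by
  intro f hf g hg hfg
  obtain ⟨x, hx⟩ := hne
  have hf' := DifferentiableOn.analyticOnNhd hf hD
  have hg' := DifferentiableOn.analyticOnNhd hg hD
  have := hf'.eqOn_of_preconnected_of_eventuallyEq hg' hDc.isPreconnected (h hx) (by
    filter_upwards [hA.mem_nhds hx] with z hz
    have e := DFunLike.congr_fun hfg ⟨z, hz⟩
    rw [show z = ((⟨z, h hz⟩ : ↥D) : ℂ) from rfl, ext_apply, ext_apply]
    exact e)
  ext z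
  have := this z.2
  rwa [ext_apply, ext_apply] at this

lemma measure_unique {X Y : Type*} [TopologicalSpace X] [PolishSpace X] [MeasurableSpace X]
    [BorelSpace X] [TopologicalSpace Y] [PolishSpace Y]
    (φ : X → Y) (hφ : Continuous φ) (H : Set X) (hH : IsClosed H) (hinj : Set.InjOn φ H)
    (μ ν : Measure X) [IsProbabilityMeasure μ] [IsProbabilityMeasure ν]
    (hμ : μ Hᶜ = 0) (hν : ν Hᶜ = 0)
    (h : ∀ f : Y →ᵇ ℝ, ∫ x, f (φ x) ∂μ = ∫ x, f (φ x) ∂ν) : μ = ν := by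
  let : MeasurableSpace Y := borel Y
  have : BorelSpace Y := ⟨rfl⟩
  let := TopologicalSpace.upgradeIsCompletelyMetrizable Y
  have hm : Measurable φ := hφ.measurable
  have := Measure.isProbabilityMeasure_map (μ := μ) hm.aemeasurable
  have := Measure.isProbabilityMeasure_map (μ := ν) hm.aemeasurable
  have hmap : μ.map φ = ν.map φ := by
    refine ext_of_forall_integral_eq_of_IsFiniteMeasure fun f => ?_
    rw [integral_map hm.aemeasurable f.continuous.aestronglyMeasurable,
      integral_map hm.aemeasurable f.continuous.aestronglyMeasurable]
    exact h f
  ext A hA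
  have hB : MeasurableSet (φ '' (A ∩ H)) :=
    (hA.inter hH.measurableSet).image_of_continuousOn_injOn hφ.continuousOn
      (hinj.mono Set.inter_subset_right)
  have key : ∀ ρ : Measure X, ρ Hᶜ = 0 → ρ A = ρ.map φ (φ '' (A ∩ H)) := by
    intro ρ hρ
    rw [Measure.map_apply hm hB]
    refine measure_congr ?_
    have hae : ∀ᵐ x ∂ρ, x ∈ H := hρ
    filter_upwards [hae] with x hx
    refine propext ⟨fun hxA => ⟨x, ⟨hxA, hx⟩, rfl⟩, ?_⟩
    rintro ⟨y, ⟨hyA, hyH⟩, hy⟩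
    have := hinj hyH hx hy
    exact this ▸ hyA
  rw [key μ hμ, key ν hν, hmap]

lemma local_tight {Ω Ω' : Type*} [MeasurableSpace Ω] [MeasurableSpace Ω']
    (P : Measure Ω) [IsProbabilityMeasure P] (P' : Measure Ω') [IsProbabilityMeasure P']
    {D A : Set ℂ} [MeasurableSpace C(↥D, ℂ)] [BorelSpace C(↥D, ℂ)]
    (hsub : A ⊆ D) (hA : IsOpen A) (x : ℂ) (hx : x ∈ A)
    (W : ℕ → Ω → C(↥D, ℂ)) (hW : ∀ n, Measurable (W n)) (Z : Ω' → C(↥A, ℂ))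
    (h : ∀ f : C(↥A, ℂ) →ᵇ ℝ, Tendsto (fun n => ∫ ω, f (restr hsub (W n ω)) ∂P) atTop
      (𝓝 (∫ ω, f (Z ω) ∂P'))) :
    ∃ r : ℝ, 0 < r ∧ ∀ δ : ℝ≥0, 0 < δ → ∃ M : ℝ, ∀ n,
      P {ω | ¬ ∀ z : ↥D, (z : ℂ) ∈ Metric.closedBall x r → ‖W n ω z‖ ≤ M} ≤ δ := by
  obtain ⟨r, hr, hball⟩ := Metric.nhds_basis_closedBall.mem_iff.1 (hA.mem_nhds hx)
  refine ⟨r, hr, fun δ hδ => ?_⟩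
  have : CompactSpace ↥(Metric.closedBall x r) :=
    isCompact_iff_compactSpace.1 (isCompact_closedBall x r)
  have hm : ∀ n, ∀ f : C(↥A, ℂ) →ᵇ ℝ,
      AEStronglyMeasurable (fun ω => f (restr hsub (W n ω))) P := fun n f =>
    ((f.continuous.comp (continuous_restr hsub)).measurable.comp (hW n)).aestronglyMeasurable
  obtain ⟨M, hM⟩ := tight_norm P P' (fun n ω => restr hsub (W n ω)) Z hm h
    (fun f => ‖restr hball f‖) (continuous_restr hball).norm δ hδ
  refine ⟨M, fun n => (measure_mono fun ω hω => ?_).trans (hM n)⟩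
  simp only [Set.mem_ofPred_eq] at hω ⊢
  by_contra hlt
  refine hω fun z hz => ?_
  exact (ContinuousMap.norm_coe_le_norm (restr hball (restr hsub (W n ω))) ⟨z, hz⟩).trans
    (not_lt.1 hlt)

lemma tight_all {Ω : Type*} [MeasurableSpace Ω]
    (P : Measure Ω) [IsProbabilityMeasure P]
    {D : Set ℂ} (hD : IsOpen D) [MeasurableSpace C(↥D, ℂ)] [BorelSpace C(↥D, ℂ)]
    (W : ℕ → Ω → C(↥D, ℂ)) (hW : ∀ n, Measurable (W n)) (hWan : ∀ n ω, W n ω ∈ holoSet D)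
    (h : ∀ x ∈ D, ∃ r : ℝ, 0 < r ∧ ∀ δ : ℝ≥0, 0 < δ → ∃ M : ℝ, ∀ n,
      P {ω | ¬ ∀ z : ↥D, (z : ℂ) ∈ Metric.closedBall x r → ‖W n ω z‖ ≤ M} ≤ δ) :
    IsTightMeasureSet (Set.range fun n => P.map (W n)) := by
  rw [isTightMeasureSet_iff_exists_isCompact_measure_compl_le]
  intro ε hε
  choose! r hr h using h
  obtain ⟨s, hs, hcov⟩ := TopologicalSpace.countable_cover_nhds
    (f := fun x : ↥D => Subtype.val ⁻¹' Metric.ball (x : ℂ) (r x))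
    (fun x => continuous_subtype_val.continuousAt.preimage_mem_nhds
      (Metric.ball_mem_nhds _ (hr x x.2)))
  have : Countable ↥s := hs
  obtain ⟨δ, hδ, hsum⟩ := ENNReal.exists_pos_sum_of_countable hε.ne' ↥s
  choose M hM using fun i : ↥s => h i.1 i.1.2 (δ i) (hδ i)
  have hK := compact_holo hD (fun i : ↥s => Metric.closedBall (i.1 : ℂ) (r i.1)) M (by
    intro x hx
    have hx' : (⟨x, hx⟩ : ↥D) ∈ ⋃ y ∈ s, Subtype.val ⁻¹' Metric.ball (y : ℂ) (r y) :=
      hcov ▸ Set.mem_univ _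
    simp only [Set.mem_iUnion] at hx'
    obtain ⟨y, hy, hxy⟩ := hx'
    exact ⟨⟨y, hy⟩, mem_of_superset (Metric.isOpen_ball.mem_nhds hxy)
      Metric.ball_subset_closedBall⟩)
  refine ⟨_, hK, ?_⟩
  rintro _ ⟨n, rfl⟩
  have : PolishSpace C(↥D, ℂ) := polish_C hD
  simp only
  rw [Measure.map_apply (hW n) hK.measurableSet.compl]
  calc P _ ≤ P (⋃ i : ↥s, {ω | ¬ ∀ z : ↥D,
          (z : ℂ) ∈ Metric.closedBall (i.1 : ℂ) (r i.1) → ‖W n ω z‖ ≤ M i}) := by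
        refine measure_mono fun ω hω => ?_
        by_contra hc
        refine hω ⟨hWan n ω, fun i => ?_⟩
        simp only [Set.mem_iUnion, Set.mem_ofPred_eq, not_exists, not_not] at hc
        exact hc i
    _ ≤ ∑' i : ↥s, (δ i : ℝ≥0∞) := (measure_iUnion_le _).trans (ENNReal.tsum_le_tsum fun i => hM i n)
    _ ≤ ε := hsum.le

/-- Theorem 4.1: if `W_n` are random analytic functions on a domain
`D ⊆ ℂ` such that for each `x ∈ D` there is an open subdomain `D_x ∋ x` and a random
analytic function `Z_x` on `D_x` with `W_n → Z_x` in distribution in `H(D_x)`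
(convergence in distribution being tested against bounded continuous functions on
the space of continuous functions with the compact-open topology), then there is a
random analytic function `Z` on `D` with `W_n → Z` in distribution in `H(D)` whose
restriction to each `D_x` has the law of `Z_x`. -/
theorem stmt19 {Ω : Type*} [MeasurableSpace Ω] (P : Measure Ω) [IsProbabilityMeasure P]
    (D : Set ℂ) (hD : IsOpen D) (hDconn : IsConnected D)
    [MeasurableSpace C(↥D, ℂ)] [BorelSpace C(↥D, ℂ)]
    (W : ℕ → Ω → C(↥D, ℂ))
    (hWmeas : ∀ n, Measurable (W n))
    (hWan : ∀ n ω, DifferentiableOn ℂ (Function.extend Subtype.val (⇑(W n ω)) 0) D)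
    (hloc : ∀ x ∈ D, ∃ (Dx : Set ℂ) (hsub : Dx ⊆ D), IsOpen Dx ∧ IsConnected Dx ∧ x ∈ Dx ∧
      ∃ (Ω' : Type) (_ : MeasurableSpace Ω') (P' : Measure Ω') (_ : IsProbabilityMeasure P')
        (Zx : Ω' → C(↥Dx, ℂ)),
        (∀ ω', DifferentiableOn ℂ (Function.extend Subtype.val (⇑(Zx ω')) 0) Dx) ∧
        ∀ f : BoundedContinuousFunction C(↥Dx, ℂ) ℝ,
          Tendsto
            (fun n => ∫ ω, f ((W n ω).comp ⟨Set.inclusion hsub, continuous_inclusion hsub⟩) ∂P)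
            atTop (𝓝 (∫ ω', f (Zx ω') ∂P'))) :
    ∃ (Ω'' : Type) (_ : MeasurableSpace Ω'') (P'' : Measure Ω'') (_ : IsProbabilityMeasure P'')
      (Z : Ω'' → C(↥D, ℂ)),
      (∀ ω'', DifferentiableOn ℂ (Function.extend Subtype.val (⇑(Z ω'')) 0) D) ∧
      (∀ f : BoundedContinuousFunction C(↥D, ℂ) ℝ,
        Tendsto (fun n => ∫ ω, f (W n ω) ∂P) atTop (𝓝 (∫ ω'', f (Z ω'') ∂P''))) ∧
      ∀ x ∈ D, ∀ (Dx : Set ℂ) (hsub : Dx ⊆ D), IsOpen Dx → x ∈ Dx →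
        ∀ (Ω' : Type) (_ : MeasurableSpace Ω') (P' : Measure Ω'), IsProbabilityMeasure P' →
        ∀ Zx : Ω' → C(↥Dx, ℂ),
          (∀ f : BoundedContinuousFunction C(↥Dx, ℂ) ℝ,
            Tendsto
              (fun n =>
                ∫ ω, f ((W n ω).comp ⟨Set.inclusion hsub, continuous_inclusion hsub⟩) ∂P)
              atTop (𝓝 (∫ ω', f (Zx ω') ∂P'))) →
          ∀ f : BoundedContinuousFunction C(↥Dx, ℂ) ℝ,
            ∫ ω'', f ((Z ω'').comp ⟨Set.inclusion hsub, continuous_inclusion hsub⟩) ∂P'' =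
              ∫ ω', f (Zx ω') ∂P' := by
  have hpol : PolishSpace C(↥D, ℂ) := polish_C hD
  have hcl := isClosed_holoSet hD
  have hWan' : ∀ n ω, W n ω ∈ holoSet D := hWan
  have htight := tight_all P hD W hWmeas hWan' (by
    intro x hx
    obtain ⟨A, hsub, hA, -, hxA, Ω', _, P', _, Z, -, hZ⟩ := hloc x hx
    exact local_tight P P' hsub hA x hxA W hWmeas Z hZ)
  let μ : ℕ → ProbabilityMeasure C(↥D, ℂ) := fun n =>
    ⟨P.map (W n), Measure.isProbabilityMeasure_map (hWmeas n).aemeasurable⟩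
  have hμint : ∀ n (f : C(↥D, ℂ) →ᵇ ℝ),
      ∫ g, f g ∂(μ n : Measure C(↥D, ℂ)) = ∫ ω, f (W n ω) ∂P := fun n f =>
    integral_map (hWmeas n).aemeasurable f.continuous.aestronglyMeasurable
  have hcompact : IsCompact (closure (Set.range μ)) := by
    refine isCompact_closure_of_isTightMeasureSet (htight.subset ?_)
    rintro _ ⟨_, ⟨n, rfl⟩, rfl⟩
    exact ⟨n, rfl⟩
  have hlim : ∀ U : Ultrafilter ℕ, ∃ m : ProbabilityMeasure C(↥D, ℂ), Tendsto μ U (𝓝 m) := by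
    intro U
    obtain ⟨m, -, hm⟩ := hcompact.ultrafilter_le_nhds (U.map μ)
      (by
        rw [le_principal_iff]
        exact mem_of_superset (Ultrafilter.mem_map.2 (univ_mem' fun n => Set.mem_range_self n)) subset_closure)
    exact ⟨m, hm⟩
  let := TopologicalSpace.upgradeIsCompletelyMetrizable C(↥D, ℂ)
  have hsupp : ∀ (U : Ultrafilter ℕ) (m : ProbabilityMeasure C(↥D, ℂ)), Tendsto μ U (𝓝 m) →
      (m : Measure C(↥D, ℂ)) (holoSet D)ᶜ = 0 := by
    intro U m hm
    have h1 := ProbabilityMeasure.le_liminf_measure_open_of_tendsto hm hcl.isOpen_compl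
    have h2 : ∀ n, (μ n : Measure C(↥D, ℂ)) (holoSet D)ᶜ = 0 := by
      intro n
      change P.map (W n) _ = 0
      rw [Measure.map_apply (hWmeas n) hcl.measurableSet.compl]
      convert! measure_empty (μ := P)
      ext ω
      simp [hWan' n ω]
    simp only [h2, liminf_const] at h1
    exact le_antisymm h1 zero_le
  obtain ⟨x₀, hx₀⟩ := hDconn.nonempty
  obtain ⟨A, hsub, hA, -, hxA, Ω', _, P', _, Z, -, hZ⟩ := hloc x₀ hx₀
  have huniq : ∀ (U V : Ultrafilter ℕ) (m m' : ProbabilityMeasure C(↥D, ℂ)),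
      (U : Filter ℕ) ≤ atTop → (V : Filter ℕ) ≤ atTop →
      Tendsto μ U (𝓝 m) → Tendsto μ V (𝓝 m') → m = m' := by
    intro U V m m' hU hV hm hm'
    have : PolishSpace C(↥A, ℂ) := polish_C hA
    have key : ∀ (U : Ultrafilter ℕ) (m : ProbabilityMeasure C(↥D, ℂ)),
        (U : Filter ℕ) ≤ atTop → Tendsto μ U (𝓝 m) → ∀ f : C(↥A, ℂ) →ᵇ ℝ,
        ∫ g, f (restr hsub g) ∂(m : Measure C(↥D, ℂ)) = ∫ ω', f (Z ω') ∂P' := by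
      intro U m hU hm f
      rw [ProbabilityMeasure.tendsto_iff_forall_integral_tendsto] at hm
      have h1 := hm (f.compContinuous ⟨restr hsub, continuous_restr hsub⟩)
      simp only [hμint] at h1
      exact tendsto_nhds_unique h1 ((hZ f).mono_left hU)
    have : IsProbabilityMeasure m.1 := m.2
    have : IsProbabilityMeasure m'.1 := m'.2
    apply Subtype.ext
    exact measure_unique (restr hsub) (continuous_restr hsub) (holoSet D) hcl
      (restr_injOn hsub hD hDconn hA ⟨x₀, hxA⟩) _ _ (hsupp U m hm) (hsupp V m' hm')
      (fun f => (key U m hU hm f).trans (key V m' hV hm' f).symm)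
  obtain ⟨m, hm⟩ := hlim (Ultrafilter.of atTop)
  have hconv : Tendsto μ atTop (𝓝 m) := by
    rw [tendsto_iff_ultrafilter]
    intro V hV
    obtain ⟨m', hm'⟩ := hlim V
    rwa [huniq _ V m m' (Ultrafilter.of_le atTop) hV hm hm']
  have hm0 := hsupp _ m hm
  rw [ProbabilityMeasure.tendsto_iff_forall_integral_tendsto] at hconv
  simp only [hμint] at hconv
  classical
  have hzero : (0 : C(↥D, ℂ)) ∈ holoSet D := by
    have : Function.extend (Subtype.val : ↥D → ℂ) (⇑(0 : C(↥D, ℂ))) 0 = fun _ => 0 := by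
      funext z
      by_cases hz : ∃ a : ↥D, (a : ℂ) = z
      · obtain ⟨a, rfl⟩ := hz
        rw [ext_apply]; rfl
      · rw [Function.extend_apply' _ _ _ hz]; rfl
    change DifferentiableOn ℂ _ D
    rw [this]
    exact differentiableOn_const 0
  let Z' : C(↥D, ℂ) → C(↥D, ℂ) := fun f => if f ∈ holoSet D then f else 0
  have hZ' : ∀ᵐ g ∂(m : Measure C(↥D, ℂ)), Z' g = g := by
    have hae : ∀ᵐ g ∂(m : Measure C(↥D, ℂ)), g ∈ holoSet D := hm0
    filter_upwards [hae] with g hg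
    exact if_pos hg
  have hmain : ∀ f : C(↥D, ℂ) →ᵇ ℝ,
      Tendsto (fun n => ∫ ω, f (W n ω) ∂P) atTop
        (𝓝 (∫ g, f (Z' g) ∂(m : Measure C(↥D, ℂ)))) := by
    intro f
    have : ∫ g, f (Z' g) ∂(m : Measure C(↥D, ℂ)) = ∫ g, f g ∂(m : Measure C(↥D, ℂ)) := by
      refine integral_congr_ae ?_
      filter_upwards [hZ'] with g hg
      rw [hg]
    rw [this]
    exact hconv f
  refine ⟨C(↥D, ℂ), inferInstance, m, inferInstance, Z', ?_, hmain, ?_⟩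
  · intro g
    change Z' g ∈ holoSet D
    by_cases hg : g ∈ holoSet D
    · simp only [Z', if_pos hg]; exact hg
    · simp only [Z', if_neg hg]; exact hzero
  · intro x hx B hB _ _ Ω₁ _ P₁ _ Z₁ hZ₁ f
    exact tendsto_nhds_unique
      (hmain (f.compContinuous ⟨restr hB, continuous_restr hB⟩)) (hZ₁ f)
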